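/- Let G be a finite directed graph on m vertices that, for every integer k ≥ 3, contains no transitively oriented cycle TC_k (the digraph on vertices 1,...,k with directed edges from i to i+1 for 1 ≤ i ≤ k−1 and from 1 to k). Then G has at most max{2(m−1), ⌊m²/4⌋} directed edges. -/

import Mathlib

open Filter

/-- An induced copy of the poset `P` inside the family `F`. -/
def InducedCopy (P : Type) [PartialOrder P] {α : Type} [PartialOrder α]
    (F : Set α) : Prop :=
  ∃ φ : P → α, Function.Injective φ ∧ (∀ x, φ x ∈ F) ∧ ∀ x y, φ x ≤ φ y ↔ x ≤ y

/-- `F` is induced `P`-free. -/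
def PFree (P : Type) [PartialOrder P] {α : Type} [PartialOrder α] (F : Set α) : Prop :=
  ¬ InducedCopy P F

/-- `F` is induced `P`-free and induced `P`-saturated. -/
def PSaturated (P : Type) [PartialOrder P] {α : Type} [PartialOrder α] (F : Set α) : Prop :=
  PFree P F ∧ ∀ g ∉ F, InducedCopy P (insert g F)

/-- The lifting operator `L_i`, copying coordinate `i` into a new last coordinate. -/
def lift {t n : ℕ} (i : Fin n) (f : Fin n → Fin t) : Fin (n + 1) → Fin t :=
  Fin.snoc f (f i)

/-- The coordinate-dropping operator `D_i`. -/
def drop {t n : ℕ} (i : Fin (n + 1)) (f : Fin (n + 1) → Fin t) : Fin n → Fin t :=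
  fun x => f (i.succAbove x)

/-- Coordinate `i` is separating for `F`. -/
def Separating {t n : ℕ} (F : Set (Fin n → Fin t)) (i : Fin n) : Prop :=
  ∃ f ∈ F, ∃ f' ∈ F, f ≠ f' ∧ (∀ x, x ≠ i → f x ≤ f' x) ∧ f' i < f i

/-- The induced saturation number `sat*([t]^n, P)`. -/
noncomputable def satStar (t n : ℕ) (P : Type) [PartialOrder P] : ℕ :=
  sInf {m | ∃ F : Set (Fin n → Fin t), PSaturated P F ∧ F.ncard = m}

/-- The antichain on `k` elements. -/
def AC (k : ℕ) := Fin k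

instance (k : ℕ) : PartialOrder (AC k) where
  le := Eq
  le_refl _ := rfl
  le_trans _ _ _ h h' := Eq.trans h h'
  le_antisymm _ _ h _ := h

/-- The unique cover twin property. -/
def UCTP (P : Type) [PartialOrder P] : Prop :=
  ∀ x y : P, y ⋖ x → ∃ y', y' ≠ y ∧ y' ≠ x ∧ y' ⋖ x


open Relation

theorem walk_of_rtg {V : Type} {R : V → V → Prop} {u v : V} (h : ReflTransGen R u v) :
    ∃ n : ℕ, ∃ w : ℕ → V, w 0 = u ∧ w n = v ∧ ∀ i < n, R (w i) (w (i + 1)) := by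
  induction h with
  | refl => exact ⟨0, fun _ => u, rfl, rfl, by simp⟩
  | @tail b c _ hbc ih =>
    obtain ⟨n, w, h0, hn, hw⟩ := ih
    refine ⟨n + 1, fun i => if i ≤ n then w i else c, by simpa using h0, by simp, ?_⟩
    intro i hi
    rcases Nat.lt_succ_iff_lt_or_eq.mp hi with h | h
    · have h1 : i ≤ n := by omega
      have h2 : i + 1 ≤ n := by omega
      simp only [h1, h2, if_true]
      exact hw i h
    · subst h
      simpa [hn] using hbc

theorem unique_path (V : Type) (E : V → V → Prop)
    (hirr : ∀ v, ¬ E v v)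
    (hfree : ∀ k, 3 ≤ k → ∀ v : ℕ → V,
      (∀ a, a < k → ∀ b, b < k → a ≠ b → v a ≠ v b) →
      ¬ ((∀ j, j + 1 < k → E (v j) (v (j + 1))) ∧ E (v 0) (v (k - 1))))
    (u v : V) (huv : E u v) :
    ¬ ReflTransGen (fun x y => E x y ∧ ¬ (x = u ∧ y = v)) u v := by
  classical
  intro h
  have hex := walk_of_rtg h
  obtain ⟨w, h0, hn, hw⟩ := Nat.find_spec hex
  have hmin := fun m => @Nat.find_min _ _ hex m
  generalize Nat.find hex = n at *
  have key : ∀ a b, a < b → b ≤ n → w a ≠ w b := by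
    intro a b hab hbn he
    refine hmin (n - (b - a)) (by omega)
      ⟨fun i => if i ≤ a then w i else w (i + (b - a)), by simpa using h0, ?_, ?_⟩
    · by_cases hc : n - (b - a) ≤ a
      · have h1 : b = n := by omega
        have h2 : n - (b - a) = a := by omega
        simp only [h2, le_refl, if_true]
        rw [he, h1, hn]
      · simp only [hc, if_false]
        rw [show n - (b - a) + (b - a) = n by omega, hn]
    · intro i hi
      rcases lt_trichotomy i a with h | h | h
      · have h1 : i ≤ a := by omega
        have h2 : i + 1 ≤ a := by omega
        simp only [h1, h2, if_true]
        exact hw i (by omega)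
      · subst h
        have h2 : ¬ (i + 1 ≤ i) := by omega
        simp only [le_refl, h2, if_true, if_false]
        rw [he, show i + 1 + (b - i) = b + 1 by omega]
        exact hw b (by omega)
      · have h1 : ¬ (i ≤ a) := by omega
        have h2 : ¬ (i + 1 ≤ a) := by omega
        simp only [h1, h2, if_false]
        rw [show i + 1 + (b - a) = i + (b - a) + 1 by omega]
        exact hw _ (by omega)
  have hn0 : n ≠ 0 := by
    rintro rfl
    have : u = v := by rw [← h0, ← hn]
    exact hirr u (this ▸ huv)
  have hn1 : n ≠ 1 := by
    rintro rfl
    exact (hw 0 (by omega)).2 ⟨h0, hn⟩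
  refine hfree (n + 1) (by omega) w ?_ ⟨fun j hj => (hw j (by omega)).1, ?_⟩
  · intro a ha b hb hab
    rcases lt_or_gt_of_ne hab with h | h
    · exact key a b h (by omega)
    · exact (key b a h (by omega)).symm
  · simpa [h0, hn] using huv

theorem parent_tree {V : Type} (R : V → V → Prop) (rep : V → V)
    (hrep : ∀ x y, R x y → rep x = rep y)
    (hreach : ∀ v, ReflTransGen R (rep v) v) :
    ∃ par : V → V, ∀ v, ReflTransGen (fun x y => R x y ∧ x = par y ∧ rep y ≠ y) (rep v) v := by
  classical
  have hex := fun v => walk_of_rtg (hreach v)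
  have hpred : ∀ v, ∃ u, rep v ≠ v → R u v ∧ Nat.find (hex u) < Nat.find (hex v) := by
    intro v
    by_cases hv : rep v = v
    · exact ⟨v, fun h => absurd hv h⟩
    obtain ⟨w, h0, hn, hw⟩ := Nat.find_spec (hex v)
    set n := Nat.find (hex v)
    have hn0 : n ≠ 0 := by
      intro h
      rw [h] at hn
      exact hv (h0.symm.trans hn)
    obtain ⟨k, hk⟩ := Nat.exists_eq_succ_of_ne_zero hn0
    have hR : R (w k) v := by
      have := hw k (by omega)
      rwa [show k + 1 = n by omega, hn] at this
    refine ⟨w k, fun _ => ⟨hR, lt_of_le_of_lt (Nat.find_min' (hex (w k)) (m := k) ?_) (by omega)⟩⟩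
    exact ⟨w, by rw [h0, hrep _ _ hR], rfl, fun i hi => hw i (by omega)⟩
  choose par hpar using hpred
  refine ⟨par, ?_⟩
  have : ∀ n v, Nat.find (hex v) = n →
      ReflTransGen (fun x y => R x y ∧ x = par y ∧ rep y ≠ y) (rep v) v := by
    intro n
    induction n using Nat.strong_induction_on with
    | _ n ih =>
      intro v hv
      by_cases h : rep v = v
      · rw [h]
      · obtain ⟨h1, h2⟩ := hpar v h
        have := ih _ (hv ▸ h2) (par v) rfl
        rw [hrep _ _ h1] at this
        exact this.tail ⟨h1, rfl, h⟩
  exact fun v => this _ v rfl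

theorem arith (m c : ℕ) (hc : c ≤ m) (h1 : m ≠ 0 → c ≠ 0) :
    2 * (m - c) + c ^ 2 / 4 ≤ max (2 * (m - 1)) (m ^ 2 / 4) := by
  obtain ⟨d, rfl⟩ := Nat.exists_eq_add_of_le hc
  rcases Nat.eq_zero_or_pos c with h0 | h0
  · have : c + d = 0 := by
      by_contra h
      exact h1 h h0
    obtain ⟨rfl, rfl⟩ : c = 0 ∧ d = 0 := by omega
    simp
  rw [Nat.add_sub_cancel_left]
  by_cases h : 8 ≤ 2 * c + d
  · apply le_max_of_le_right
    rw [Nat.le_div_iff_mul_le (by norm_num)]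
    have := Nat.div_mul_le_self (c ^ 2) 4
    nlinarith
  · apply le_max_of_le_left
    have : c ≤ 3 := by
      by_contra h2
      omega
    interval_cases c <;> omega

theorem stmt4 (V : Type) [Fintype V] (E : V → V → Prop)
    (hirr : ∀ v, ¬ E v v)
    (hfree : ∀ k, 3 ≤ k → ∀ v : ℕ → V,
      (∀ a, a < k → ∀ b, b < k → a ≠ b → v a ≠ v b) →
      ¬ ((∀ j, j + 1 < k → E (v j) (v (j + 1))) ∧ E (v 0) (v (k - 1)))) :
    {p : V × V | E p.1 p.2}.ncard ≤
      max (2 * (Fintype.card V - 1)) (Fintype.card V ^ 2 / 4) := by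
  classical
  have hP := unique_path V E hirr hfree
  let s : Setoid V :=
    { r := fun u v => ReflTransGen E u v ∧ ReflTransGen E v u
      iseqv := ⟨fun _ => ⟨.refl, .refl⟩, fun h => ⟨h.2, h.1⟩,
        fun h h' => ⟨h.1.trans h'.1, h'.2.trans h.2⟩⟩ }
  let q : V → Quotient s := Quotient.mk s
  have hq : ∀ u v, q u = q v ↔ (ReflTransGen E u v ∧ ReflTransGen E v u) :=
    fun u v => Quotient.eq (r := s)
  let R : V → V → Prop := fun x y => E x y ∧ q x = q y
  have hin : ∀ u v, q u = q v → ReflTransGen R u v := by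
    intro u v h
    obtain ⟨h1, h2⟩ := (hq u v).1 h
    clear h
    induction h1 with
    | refl => exact .refl
    | @tail b c hub hbc ih =>
      have hbu : ReflTransGen E b u := ReflTransGen.head hbc h2
      exact (ih hbu).tail ⟨hbc, (hq _ _).2 ⟨.single hbc, h2.trans hub⟩⟩
  have hav : ∀ a c, q a ≠ q c → ∀ u v, q u = q v →
      ReflTransGen (fun x y => E x y ∧ ¬ (x = a ∧ y = c)) u v := by
    intro a c hac u v huv
    refine ReflTransGen.mono ?_ _ _ (hin u v huv)
    rintro x y ⟨h1, h2⟩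
    exact ⟨h1, by rintro ⟨rfl, rfl⟩; exact hac h2⟩
  have huniq : ∀ a c a' c', E a c → E a' c' → q a = q a' → q c = q c' → q a ≠ q c →
      a = a' ∧ c = c' := by
    intro a c a' c' h1 h2 ha hc hac
    by_contra hne
    refine hP a c h1 (((hav a c hac a a' ha).tail ⟨h2, ?_⟩).trans (hav a c hac c' c hc.symm))
    rintro ⟨rfl, rfl⟩
    exact hne ⟨rfl, rfl⟩
  let F : Quotient s → Quotient s → Prop := fun A B => ∃ a b, E a b ∧ q a = A ∧ q b = B
  have hFreach : ∀ u v, F (q u) (q v) → ReflTransGen E u v := by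
    rintro u v ⟨a, b, hab, ha, hb⟩
    exact (((hq _ _).1 ha).2.tail hab).trans ((hq _ _).1 hb).1
  have hFanti : ∀ A B, F A B → F B A → A = B := by
    intro A B
    obtain ⟨a, rfl⟩ := Quotient.exists_rep A
    obtain ⟨b, rfl⟩ := Quotient.exists_rep B
    exact fun h1 h2 => (hq a b).2 ⟨hFreach a b h1, hFreach b a h2⟩
  have hFcyc : ∀ A B C, F A B → F B C → F C A → A = B := by
    intro A B C
    obtain ⟨a, rfl⟩ := Quotient.exists_rep A
    obtain ⟨b, rfl⟩ := Quotient.exists_rep B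
    obtain ⟨c, rfl⟩ := Quotient.exists_rep C
    exact fun h1 h2 h3 =>
      (hq a b).2 ⟨hFreach a b h1, (hFreach b c h2).trans (hFreach c a h3)⟩
  have hFtri : ∀ A B C, A ≠ B → B ≠ C → A ≠ C → F A B → F B C → F A C → False := by
    rintro A B C hAB hBC hAC ⟨a', b1, h1, rfl, rfl⟩ ⟨b2, c', h2, hb, rfl⟩ ⟨a, c, h3, ha, hc⟩
    have hac : q a ≠ q c := by rw [ha, hc]; exact hAC
    refine hP a c h3 (((((hav a c hac a a' ha).tail ⟨h1, ?_⟩).trans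
      (hav a c hac b1 b2 hb.symm)).tail ⟨h2, ?_⟩).trans (hav a c hac c' c hc.symm))
    · rintro ⟨rfl, rfl⟩
      exact hBC hc
    · rintro ⟨rfl, rfl⟩
      exact hAB (ha.symm.trans hb)
  -- the condensation is triangle-free
  let H : SimpleGraph (Quotient s) :=
    { Adj := fun A B => A ≠ B ∧ (F A B ∨ F B A)
      symm := ⟨fun A B h => ⟨h.1.symm, h.2.symm⟩⟩
      loopless := ⟨fun A h => h.1 rfl⟩ }
  have hH : H.CliqueFree 3 := by
    intro t ht
    obtain ⟨A, B, C, hAB, hAC, hBC, -⟩ := SimpleGraph.is3Clique_iff.1 ht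
    obtain ⟨nAB, hAB⟩ := hAB
    obtain ⟨nAC, hAC⟩ := hAC
    obtain ⟨nBC, hBC⟩ := hBC
    rcases hAB with h1 | h1 <;> rcases hAC with h2 | h2 <;> rcases hBC with h3 | h3
    · exact hFtri A B C nAB nBC nAC h1 h3 h2
    · exact hFtri A C B nAC nBC.symm nAB h2 h3 h1
    · exact nAB (hFcyc A B C h1 h3 h2)
    · exact hFtri C A B nAC.symm nAB nBC.symm h2 h1 h3
    · exact hFtri B A C nAB.symm nAC nBC h1 h2 h3
    · exact nAC (hFcyc A C B h2 h3 h1)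
    · exact hFtri B C A nBC nAC.symm nAB.symm h3 h2 h1
    · exact hFtri C B A nBC.symm nAB.symm nAC.symm h3 h1 h2
  set c := Fintype.card (Quotient s) with hc
  set m := Fintype.card V with hm
  have hmantel : H.edgeFinset.card ≤ c ^ 2 / 4 := by
    have h := SimpleGraph.CliqueFree.card_edgeFinset_le (r := 2) hH
    simp only [← hc] at h
    refine h.trans ?_
    rcases Nat.mod_two_eq_zero_or_one c with h | h <;> rw [h] <;> simp
    omega
  have hcm : c ≤ m := Fintype.card_quotient_le s
  have hc0 : m ≠ 0 → c ≠ 0 := by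
    intro h
    obtain ⟨x⟩ := Fintype.card_pos_iff.1 (Nat.pos_of_ne_zero h)
    exact (Fintype.card_pos_iff.2 ⟨q x⟩).ne'
  -- trees in the components
  let rep : V → V := fun v => (q v).out
  have hqrep : ∀ v, q (rep v) = q v := fun v => Quotient.out_eq (q v)
  obtain ⟨par, hpar⟩ := parent_tree R rep (fun x y h => congrArg Quotient.out h.2)
    (fun v => hin _ _ (hqrep v))
  obtain ⟨nxt, hnxt⟩ := parent_tree (fun x y => R y x) rep
    (fun x y h => congrArg Quotient.out h.2.symm)
    (fun v => (hin _ _ (hqrep v).symm).swap)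
  let N : Finset V := Finset.univ.filter fun v => rep v ≠ v
  have hN : N.card ≤ m - c := by
    have h1 : (Finset.univ.image (Quotient.out : Quotient s → V)).card = c := by
      rw [Finset.card_image_of_injective _ (Quotient.out_injective)]
      rfl
    have h2 : N ⊆ (Finset.univ.image (Quotient.out : Quotient s → V))ᶜ := by
      intro v hv
      simp only [N, Finset.mem_filter, Finset.mem_univ, true_and] at hv
      simp only [Finset.mem_compl, Finset.mem_image, Finset.mem_univ, true_and, not_exists]
      rintro A rfl
      apply hv
      exact congrArg Quotient.out (Quotient.out_eq A)
    have := Finset.card_le_card h2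
    rwa [Finset.card_compl, h1] at this
  let S : Finset (V × V) := Finset.univ.filter fun p => E p.1 p.2
  have hS : {p : V × V | E p.1 p.2}.ncard = S.card := by
    rw [← Set.ncard_coe_finset]
    congr 1
    ext p
    simp [S]
  have hSin : (S.filter fun p => q p.1 = q p.2).card ≤ 2 * (m - c) := by
    have hsub : (S.filter fun p => q p.1 = q p.2) ⊆
        N.image (fun v => (par v, v)) ∪ N.image (fun v => (v, nxt v)) := by
      rintro ⟨u, v⟩ huv
      simp only [S, Finset.mem_filter, Finset.mem_univ, true_and] at huv
      obtain ⟨huv, hquv⟩ := huv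
      by_contra hcon
      simp only [N, Finset.mem_union, Finset.mem_image, Finset.mem_filter, Finset.mem_univ,
        true_and, Prod.mk.injEq, not_or, not_exists, not_and] at hcon
      obtain ⟨c1, c2⟩ := hcon
      have hr : rep u = rep v := congrArg Quotient.out hquv
      have e1 : ReflTransGen (fun x y => E x y ∧ ¬ (x = u ∧ y = v)) u (rep u) := by
        refine ReflTransGen.mono ?_ _ _ (hnxt u).swap
        rintro x y ⟨h1, h2, h3⟩
        refine ⟨h1.1, ?_⟩
        rintro ⟨rfl, rfl⟩
        exact c2 x h3 rfl h2.symm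
      have e2 : ReflTransGen (fun x y => E x y ∧ ¬ (x = u ∧ y = v)) (rep v) v := by
        refine ReflTransGen.mono ?_ _ _ (hpar v)
        rintro x y ⟨h1, h2, h3⟩
        refine ⟨h1.1, ?_⟩
        rintro ⟨rfl, rfl⟩
        exact c1 y h3 h2.symm rfl
      exact hP u v huv (e1.trans (hr ▸ e2))
    have h1 := Finset.card_le_card hsub
    have h2 := Finset.card_union_le (N.image (fun v => (par v, v))) (N.image (fun v => (v, nxt v)))
    have h3 := Finset.card_image_le (s := N) (f := fun v => (par v, v))
    have h4 := Finset.card_image_le (s := N) (f := fun v => (v, nxt v))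
    omega
  have hSout : (S.filter fun p => ¬ q p.1 = q p.2).card ≤ H.edgeFinset.card := by
    refine Finset.card_le_card_of_injOn (fun p => s(q p.1, q p.2)) ?_ ?_
    · rintro ⟨u, v⟩ huv
      simp only [S, Finset.coe_filter, Finset.mem_filter, Finset.mem_univ, true_and,
        Set.mem_ofPred_eq] at huv
      simp only [SimpleGraph.coe_edgeFinset, SimpleGraph.mem_edgeSet]
      exact ⟨huv.2, Or.inl ⟨u, v, huv.1, rfl, rfl⟩⟩
    · rintro ⟨u, v⟩ huv ⟨u', v'⟩ huv' he
      simp only [S, Finset.coe_filter, Finset.mem_filter, Finset.mem_univ, true_and,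
        Set.mem_ofPred_eq] at huv huv'
      simp only [Sym2.eq_iff] at he
      rcases he with ⟨h1, h2⟩ | ⟨h1, h2⟩
      · obtain ⟨rfl, rfl⟩ := huniq u v u' v' huv.1 huv'.1 h1 h2 huv.2
        rfl
      · exact absurd (hFanti (q u) (q v) ⟨u, v, huv.1, rfl, rfl⟩
          ⟨u', v', huv'.1, h2.symm, h1.symm⟩) huv.2
  rw [hS, ← Finset.card_filter_add_card_filter_not (s := S) (fun p => q p.1 = q p.2)]
  exact (add_le_add hSin (hSout.trans hmantel)).trans (arith m c hcm hc0)
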